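/- arXiv:2508.02924 — 2 statements merged into one kernel-verified Lean document; each statement's English description precedes it below -/
import Mathlib

section
/- Let E be a real inner product space, n ≥ 1, and g₁,…,gₙ ∈ E nonzero vectors. Fix a ∈ E, a step size α ∈ ℝ, and a batch size m ≥ 1. For a probability vector p with pᵢ > 0 for all i, define the batch estimator ḡ_p(i₁,…,i_m) = (1/m)·∑_{k=1}^{m} (1/(n·p_{i_k}))·g_{i_k} for (i₁,…,i_m) ∈ {1,…,n}^m, and the expected progress Δ(p) = ‖a‖² − ∑_{(i₁,…,i_m)∈{1,…,n}^m} (∏_{k=1}^{m} p_{i_k}) · ‖a + α·ḡ_p(i₁,…,i_m)‖². Let p* be the probability vector with p*ᵢ = ‖gᵢ‖ / ∑_{j=1}^{n} ‖gⱼ‖. Then for every probability vector q with qᵢ > 0 for all i, Δ(p*) ≥ Δ(q); that is, the distribution proportional to the boosting-weight norms maximizes the expected training progress of importance-sampling-based boosting. -/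
open Finset

/-- Bias-variance identity for a single draw from `p`. -/
lemma sum_mul_norm_add_sq {ι E : Type*} [Fintype ι] [NormedAddCommGroup E]
    [InnerProductSpace ℝ E] {p : ι → ℝ} (hp : ∑ i, p i = 1) (x : ι → E) (c : E) :
    ∑ i, p i * ‖c + x i‖ ^ 2 =
      ‖c + ∑ i, p i • x i‖ ^ 2 + (∑ i, p i * ‖x i‖ ^ 2 - ‖∑ i, p i • x i‖ ^ 2) := by
  simp only [norm_add_sq_real, inner_sum, real_inner_smul_right, mul_add, sum_add_distrib,
    ← sum_mul, hp, mul_sum]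
  have h : ∑ i, p i * (2 * inner ℝ c (x i)) = ∑ i, 2 * (p i * inner ℝ c (x i)) :=
    sum_congr rfl fun i _ => by ring
  rw [h]
  ring

/-- Bias-variance identity for the sum of `m` independent draws from `p`. -/
lemma sum_prod_mul_norm_add_sum_sq {ι E : Type*} [Fintype ι] [NormedAddCommGroup E]
    [InnerProductSpace ℝ E] {p : ι → ℝ} (hp : ∑ i, p i = 1) (x : ι → E) (m : ℕ) (b : E) :
    ∑ I : Fin m → ι, (∏ k, p (I k)) * ‖b + ∑ k, x (I k)‖ ^ 2 =
      ‖b + (m : ℝ) • ∑ i, p i • x i‖ ^ 2 +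
        m * (∑ i, p i * ‖x i‖ ^ 2 - ‖∑ i, p i • x i‖ ^ 2) := by
  induction m generalizing b with
  | zero => simp
  | succ m ih =>
    rw [← (Fin.consEquiv fun _ : Fin (m + 1) => ι).sum_comp, Fintype.sum_prod_type]
    simp only [Fin.consEquiv_apply, Fin.prod_univ_succ, Fin.sum_univ_succ, Fin.cons_zero,
      Fin.cons_succ, mul_assoc, ← mul_sum, ← add_assoc, ih]
    simp only [mul_add (p _), sum_add_distrib, ← sum_mul, hp, one_mul,
      fun i => add_right_comm b (x i), sum_mul_norm_add_sq hp]
    rw [Nat.cast_succ, add_smul, one_smul, add_assoc b]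
    ring

/-- The expected squared distance of an importance-sampled step depends on the sampling
distribution `p` only through `∑ i, ‖g i‖ ^ 2 / p i`. -/
lemma sum_prod_mul_norm_add_importance_sq {ι E : Type*} [Fintype ι] [NormedAddCommGroup E]
    [InnerProductSpace ℝ E] {p : ι → ℝ} (hp0 : ∀ i, 0 < p i) (hp : ∑ i, p i = 1)
    (g : ι → E) (m : ℕ) (b : E) (c : ℝ) :
    ∑ I : Fin m → ι, (∏ k, p (I k)) * ‖b + ∑ k, (c * (p (I k))⁻¹) • g (I k)‖ ^ 2 =
      ‖b + (m : ℝ) • c • ∑ i, g i‖ ^ 2 +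
        m * (c ^ 2 * ∑ i, ‖g i‖ ^ 2 / p i - ‖c • ∑ i, g i‖ ^ 2) := by
  have hmean : ∑ i, p i • (c * (p i)⁻¹) • g i = c • ∑ i, g i := by
    rw [smul_sum]
    refine sum_congr rfl fun i _ => ?_
    rw [smul_smul, mul_left_comm, mul_inv_cancel₀ (hp0 i).ne', mul_one]
  have hsq : ∑ i, p i * ‖(c * (p i)⁻¹) • g i‖ ^ 2 = c ^ 2 * ∑ i, ‖g i‖ ^ 2 / p i := by
    rw [mul_sum]
    refine sum_congr rfl fun i _ => ?_
    have := (hp0 i).ne'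
    rw [norm_smul, mul_pow, Real.norm_eq_abs, sq_abs]
    field_simp
  rw [sum_prod_mul_norm_add_sum_sq hp (fun i => (c * (p i)⁻¹) • g i), hmean, hsq]

/-- The sampling distribution proportional to the boosting-weight (gradient) norms
maximizes the expected training progress of importance-sampling-based boosting. -/
theorem optimal_importance_sampling_maximizes_progress
    {E : Type*} [NormedAddCommGroup E] [InnerProductSpace ℝ E]
    (n m : ℕ) (hn : 1 ≤ n) (hm : 1 ≤ m)
    (g : Fin n → E) (hg : ∀ i, g i ≠ 0)
    (a : E) (α : ℝ)
    (gbar : (Fin n → ℝ) → (Fin m → Fin n) → E)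
    (hgbar : ∀ (p : Fin n → ℝ) (I : Fin m → Fin n),
      gbar p I = ((m : ℝ))⁻¹ • ∑ k : Fin m, (((n : ℝ) * p (I k))⁻¹) • g (I k))
    (Δ : (Fin n → ℝ) → ℝ)
    (hΔ : ∀ p : Fin n → ℝ,
      Δ p = ‖a‖ ^ 2 - ∑ I : Fin m → Fin n, (∏ k : Fin m, p (I k)) * ‖a + α • gbar p I‖ ^ 2)
    (pstar : Fin n → ℝ) (hpstar : ∀ i, pstar i = ‖g i‖ / ∑ j : Fin n, ‖g j‖)
    (q : Fin n → ℝ) (hq0 : ∀ i, 0 < q i) (hq1 : ∑ i, q i = 1) :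
    Δ q ≤ Δ pstar := by
  have key (p : Fin n → ℝ) (hp0 : ∀ i, 0 < p i) (hp : ∑ i, p i = 1) :=
    sum_prod_mul_norm_add_importance_sq hp0 hp g m a (α * (m : ℝ)⁻¹ * (n : ℝ)⁻¹)
  have hstep (p : Fin n → ℝ) (I : Fin m → Fin n) : α • gbar p I =
      ∑ k, (α * (m : ℝ)⁻¹ * (n : ℝ)⁻¹ * (p (I k))⁻¹) • g (I k) := by
    simp only [hgbar, smul_sum, smul_smul, mul_inv, mul_assoc]
  have : Nonempty (Fin n) := ⟨⟨0, hn⟩⟩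
  have hpos : 0 < ∑ j, ‖g j‖ := sum_pos (fun i _ => norm_pos_iff.2 (hg i)) univ_nonempty
  have hs0 : ∀ i, 0 < pstar i := fun i => by
    rw [hpstar]
    exact div_pos (norm_pos_iff.2 (hg i)) hpos
  have hs1 : ∑ i, pstar i = 1 := by
    simp only [hpstar, ← sum_div]
    exact div_self hpos.ne'
  have hsum : ∑ i, ‖g i‖ ^ 2 / pstar i = (∑ i, ‖g i‖) ^ 2 := by
    rw [sq (∑ i, ‖g i‖), sum_mul]
    refine sum_congr rfl fun i _ => ?_
    have := (norm_pos_iff.2 (hg i)).ne'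
    rw [hpstar]
    field_simp
  have hle : (∑ i, ‖g i‖) ^ 2 ≤ ∑ i, ‖g i‖ ^ 2 / q i := by
    simpa [hq1] using sq_sum_div_le_sum_sq_div univ (fun i => ‖g i‖) (fun i _ => hq0 i)
  rw [hΔ, hΔ]
  simp only [hstep]
  rw [key q hq0 hq1, key pstar hs0 hs1, hsum]
  gcongr
end

section
/- Let E be a real inner product space, n ≥ 1, and let g₁,…,gₙ ∈ E with gᵢ ≠ 0 for all i. Define p*ᵢ = ‖gᵢ‖ / ∑_{j=1}^{n} ‖gⱼ‖. Then for every probability vector q on {1,…,n} with qᵢ > 0 for all i, ∑_{i=1}^{n} (1/p*ᵢ)·‖gᵢ‖² ≤ ∑_{i=1}^{n} (1/qᵢ)·‖gᵢ‖²; that is, the distribution proportional to the gradient norms minimizes the quantity ∑_{i=1}^{n} (1/pᵢ)·‖gᵢ‖² over all fully supported probability vectors. -/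
open Finset

/-- The distribution proportional to the gradient norms minimizes
∑ᵢ (1/pᵢ)·‖gᵢ‖² over all fully supported probability vectors. -/
theorem pstar_minimizes_variance_term
    {E : Type*} [NormedAddCommGroup E] [InnerProductSpace ℝ E]
    (n : ℕ) (hn : 1 ≤ n)
    (g : Fin n → E) (hg : ∀ i, g i ≠ 0)
    (pstar : Fin n → ℝ) (hpstar : ∀ i, pstar i = ‖g i‖ / ∑ j : Fin n, ‖g j‖)
    (q : Fin n → ℝ) (hq0 : ∀ i, 0 < q i) (hq1 : ∑ i, q i = 1) :
    ∑ i, (pstar i)⁻¹ * ‖g i‖ ^ 2 ≤ ∑ i, (q i)⁻¹ * ‖g i‖ ^ 2 := by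
  have hterm : ∀ i, (pstar i)⁻¹ * ‖g i‖ ^ 2 = (∑ j, ‖g j‖) * ‖g i‖ := fun i => by
    have hi : ‖g i‖ ≠ 0 := norm_ne_zero_iff.mpr (hg i)
    rw [hpstar, inv_div]
    field_simp
  calc ∑ i, (pstar i)⁻¹ * ‖g i‖ ^ 2
      = (∑ i, ‖g i‖) ^ 2 / ∑ i, q i := by
        rw [sum_congr rfl fun i _ => hterm i, ← mul_sum, hq1, div_one, sq]
    _ ≤ ∑ i, ‖g i‖ ^ 2 / q i := sq_sum_div_le_sum_sq_div univ _ fun i _ => hq0 i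
    _ = ∑ i, (q i)⁻¹ * ‖g i‖ ^ 2 := sum_congr rfl fun i _ => div_eq_inv_mul _ _
end
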